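/- Assume the Section 3 setup, with u the least nonnegative integer such that the tangent cone of F_{t-1} contains a monomial X^{2^u}Y^ℓ for some ℓ, and with F_{t+1}, F_{t+2} defined as in the setup. Define o(i) and m as follows: for 3 ≤ i ≤ d, o(i) = 2^{u-1}(t+1) - 1 - 2^{u-1}·i + 2^u + 2 if i is odd, o(i) = (2^{v₂(i)} + 1)(2^{u-1}(t+1) - 1) - 2^{u-1}·i + 2^u + 2 if i is even (v₂ the 2-adic valuation), and m = min{ o(i) : 3 ≤ i ≤ d, A_i ≠ 0 }. Then every monomial X^a Y^b occurring in F_{t+2} with a + b < m has both a even and b even. -/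

import Mathlib

open MvPolynomial

noncomputable section

/-- The smallest total degree of a monomial occurring in `P`. -/
def minMonomialDeg {K : Type*} [Field K] (P : MvPolynomial (Fin 2) K) : ℕ :=
  sInf {m : ℕ | ∃ s ∈ P.support, (s.sum fun _ e => e) = m}

/-- The tangent cone of `P` at the origin: the nonzero homogeneous component of
lowest total degree (for `P ≠ 0`). -/
def tangentCone {K : Type*} [Field K] (P : MvPolynomial (Fin 2) K) : MvPolynomial (Fin 2) K :=
  homogeneousComponent (minMonomialDeg P) P

/-- The exponent vector of `X ^ a * Y ^ b`. -/
def expXY (a b : ℕ) : Fin 2 →₀ ℕ := Finsupp.single 0 a + Finsupp.single 1 b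

@[simp] lemma expXY_zero (a b : ℕ) : expXY a b 0 = a := by simp [expXY]

@[simp] lemma expXY_one (a b : ℕ) : expXY a b 1 = b := by simp [expXY]

lemma expXY_inj {a b a' b' : ℕ} : expXY a b = expXY a' b' ↔ a = a' ∧ b = b' := by
  constructor
  · intro h
    exact ⟨by simpa using DFunLike.congr_fun h 0, by simpa using DFunLike.congr_fun h 1⟩
  · rintro ⟨rfl, rfl⟩
    rfl

lemma eq_expXY (s : Fin 2 →₀ ℕ) : s = expXY (s 0) (s 1) := by
  ext i
  fin_cases i <;> simp

lemma sum_expXY (a b : ℕ) : ((expXY a b).sum fun _ e => e) = a + b := by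
  rw [Finsupp.sum_fintype _ _ (by simp)]
  simp

section Substitution

variable {K : Type*} [Field K]

lemma C_mul_X_pow_mul_X_pow (c : K) (a b : ℕ) :
    (C c * (X 0 ^ a * X 1 ^ b) : MvPolynomial (Fin 2) K) = monomial (expXY a b) c := by
  rw [X_pow_eq_monomial, X_pow_eq_monomial, monomial_mul, C_mul_monomial]
  simp [expXY]

lemma aeval_monomial_expXY (p q r s a b : ℕ) (c : K) :
    aeval ![(X 0 ^ p * X 1 ^ q : MvPolynomial (Fin 2) K), X 0 ^ r * X 1 ^ s]
      (monomial (expXY a b) c) = monomial (expXY (p * a + r * b) (q * a + s * b)) c := by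
  rw [← C_mul_X_pow_mul_X_pow, ← C_mul_X_pow_mul_X_pow]
  simp only [map_mul, map_pow, aeval_X, Matrix.cons_val_zero, Matrix.cons_val_one,
    algHom_C, algebraMap_eq]
  ring

lemma coeff_aeval_expXY (p q r s : ℕ) (P : MvPolynomial (Fin 2) K) (v : Fin 2 →₀ ℕ) :
    coeff v (aeval ![(X 0 ^ p * X 1 ^ q : MvPolynomial (Fin 2) K), X 0 ^ r * X 1 ^ s] P) =
      ∑ w ∈ P.support,
        if expXY (p * w 0 + r * w 1) (q * w 0 + s * w 1) = v then coeff w P else 0 := by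
  classical
  conv_lhs => rw [P.as_sum, map_sum, coeff_sum]
  refine Finset.sum_congr rfl fun w _ => ?_
  have h := aeval_monomial_expXY p q r s (w 0) (w 1) (coeff w P)
  rw [← eq_expXY w] at h
  rw [h, coeff_monomial]

lemma exists_of_coeff_aeval_ne_zero {p q r s a b : ℕ} {P : MvPolynomial (Fin 2) K}
    (h : coeff (expXY a b)
      (aeval ![(X 0 ^ p * X 1 ^ q : MvPolynomial (Fin 2) K), X 0 ^ r * X 1 ^ s] P) ≠ 0) :
    ∃ k y, coeff (expXY k y) P ≠ 0 ∧ p * k + r * y = a ∧ q * k + s * y = b := by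
  rw [coeff_aeval_expXY] at h
  obtain ⟨w, -, hw⟩ := Finset.exists_ne_zero_of_sum_ne_zero h
  rw [ne_eq, ite_eq_right_iff, Classical.not_imp] at hw
  refine ⟨w 0, w 1, ?_, expXY_inj.1 hw.1⟩
  rw [← eq_expXY]
  exact hw.2

lemma coeff_aeval_of_injective {p q r s : ℕ}
    (hinj : ∀ k y k' y', p * k + r * y = p * k' + r * y' → q * k + s * y = q * k' + s * y' →
      k = k' ∧ y = y') (P : MvPolynomial (Fin 2) K) (k y : ℕ) :
    coeff (expXY (p * k + r * y) (q * k + s * y))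
      (aeval ![(X 0 ^ p * X 1 ^ q : MvPolynomial (Fin 2) K), X 0 ^ r * X 1 ^ s] P) =
      coeff (expXY k y) P := by
  rw [coeff_aeval_expXY, Finset.sum_eq_single (expXY k y)]
  · simp
  · intro w _ hw
    rw [if_neg]
    intro h
    obtain ⟨h1, h2⟩ := expXY_inj.1 h
    obtain ⟨h3, h4⟩ := hinj _ _ _ _ h1 h2
    exact hw (by rw [eq_expXY w, h3, h4])
  · intro h
    simpa using h

lemma coeff_mul_X_zero_pow (P : MvPolynomial (Fin 2) K) (a b n : ℕ) :
    coeff (expXY (a + n) b) (P * X 0 ^ n) = coeff (expXY a b) P := by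
  have : expXY (a + n) b = expXY a b + Finsupp.single 0 n := by
    ext i
    fin_cases i <;> simp
  rw [this, X_pow_eq_monomial, coeff_mul_monomial, mul_one]

lemma coeff_mul_X_one_pow (P : MvPolynomial (Fin 2) K) (a b n : ℕ) :
    coeff (expXY a (b + n)) (P * X 1 ^ n) = coeff (expXY a b) P := by
  have : expXY a (b + n) = expXY a b + Finsupp.single 1 n := by
    ext i
    fin_cases i <;> simp
  rw [this, X_pow_eq_monomial, coeff_mul_monomial, mul_one]

lemma le_of_coeff_mul_X_zero_pow_ne_zero {P : MvPolynomial (Fin 2) K} {a b n : ℕ}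
    (h : coeff (expXY a b) (P * X 0 ^ n) ≠ 0) : n ≤ a := by
  classical
  rw [X_pow_eq_monomial, coeff_mul_monomial', mul_one] at h
  simp only [ne_eq, ite_eq_right_iff, Classical.not_imp] at h
  simpa using h.1 0

lemma le_of_coeff_mul_X_one_pow_ne_zero {P : MvPolynomial (Fin 2) K} {a b n : ℕ}
    (h : coeff (expXY a b) (P * X 1 ^ n) ≠ 0) : n ≤ b := by
  classical
  rw [X_pow_eq_monomial, coeff_mul_monomial', mul_one] at h
  simp only [ne_eq, ite_eq_right_iff, Classical.not_imp] at h
  simpa using h.1 1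

/-- Coefficients after the substitution `X ↦ X * Y ^ w` followed by division by `Y ^ n`. -/
lemma coeff_of_mul_eq_aeval_left {P Q : MvPolynomial (Fin 2) K} {n w : ℕ}
    (h : Q * X 1 ^ n = aeval ![X 0 * X 1 ^ w, X 1] P) {k y y' : ℕ} (hy : y + n = w * k + y') :
    coeff (expXY k y) Q = coeff (expXY k y') P := by
  rw [← coeff_mul_X_one_pow Q k y n, h, hy]
  have := coeff_aeval_of_injective (p := 1) (q := w) (r := 0) (s := 1)
    (fun k y k' y' h1 h2 => by
      have : k = k' := by omega
      subst this
      exact ⟨rfl, by omega⟩) P k y'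
  simpa using this

lemma exists_of_mul_eq_aeval_left {P Q : MvPolynomial (Fin 2) K} {n w : ℕ}
    (h : Q * X 1 ^ n = aeval ![X 0 * X 1 ^ w, X 1] P) {k y : ℕ}
    (hQ : coeff (expXY k y) Q ≠ 0) : ∃ y', y + n = w * k + y' ∧ coeff (expXY k y') P ≠ 0 := by
  rw [← coeff_mul_X_one_pow Q k y n, h] at hQ
  obtain ⟨k', y', hP, h1, h2⟩ := exists_of_coeff_aeval_ne_zero (p := 1) (q := w) (r := 0) (s := 1)
    (P := P) (a := k) (b := y + n) (by simpa using hQ)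
  obtain rfl : k' = k := by omega
  exact ⟨y', by omega, hP⟩

lemma le_of_mul_eq_aeval_left {P Q : MvPolynomial (Fin 2) K} {n w : ℕ}
    (h : Q * X 1 ^ n = aeval ![X 0 * X 1 ^ w, X 1] P) {k y' : ℕ}
    (hP : coeff (expXY k y') P ≠ 0) : n ≤ w * k + y' := by
  apply le_of_coeff_mul_X_one_pow_ne_zero (P := Q) (a := k)
  rw [h]
  have := coeff_aeval_of_injective (p := 1) (q := w) (r := 0) (s := 1)
    (fun k y k' y' h1 h2 => by
      have : k = k' := by omega
      subst this
      exact ⟨rfl, by omega⟩) P k y'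
  rw [← this] at hP
  simpa using hP

lemma exists_of_mul_eq_aeval_right {P Q : MvPolynomial (Fin 2) K} {n : ℕ}
    (h : Q * X 0 ^ n = aeval ![X 0, X 0 * X 1] P) {a b : ℕ}
    (hQ : coeff (expXY a b) Q ≠ 0) : ∃ k, a + n = k + b ∧ coeff (expXY k b) P ≠ 0 := by
  rw [← coeff_mul_X_zero_pow Q a b n, h] at hQ
  obtain ⟨k, y, hP, h1, h2⟩ := exists_of_coeff_aeval_ne_zero (p := 1) (q := 0) (r := 1) (s := 1)
    (P := P) (a := a + n) (b := b) (by simpa using hQ)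
  obtain rfl : y = b := by omega
  exact ⟨k, by omega, hP⟩

lemma le_of_mul_eq_aeval_right {P Q : MvPolynomial (Fin 2) K} {n : ℕ}
    (h : Q * X 0 ^ n = aeval ![X 0, X 0 * X 1] P) {k y : ℕ}
    (hP : coeff (expXY k y) P ≠ 0) : n ≤ k + y := by
  apply le_of_coeff_mul_X_zero_pow_ne_zero (P := Q) (b := y)
  rw [h]
  have := coeff_aeval_of_injective (p := 1) (q := 0) (r := 1) (s := 1)
    (fun k y k' y' h1 h2 => by omega) P k y
  rw [← this] at hP
  simpa using hP

/-- Iterating the substitution `X ↦ X * Y` with divisions by powers of `Y`. -/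
lemma exists_aeval_iterate (F : ℕ → MvPolynomial (Fin 2) K) (nseq : ℕ → ℕ)
    (hF : ∀ r, 1 ≤ r → F r * X 1 ^ nseq r = aeval ![X 0 * X 1, X 1] (F (r - 1))) (t : ℕ) :
    ∃ N, F t * X 1 ^ N = aeval ![X 0 * X 1 ^ t, X 1] (F 0) := by
  induction t with
  | zero =>
    refine ⟨0, ?_⟩
    have : (![X 0, X 1] : Fin 2 → MvPolynomial (Fin 2) K) = X := by
      ext i
      fin_cases i <;> rfl
    simp [this]
  | succ t ih =>
    obtain ⟨N, hN⟩ := ih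
    refine ⟨nseq (t + 1) + N, ?_⟩
    have h := hF (t + 1) (by omega)
    simp only [Nat.add_sub_cancel] at h
    have h2 := congrArg (aeval ![(X 0 * X 1 : MvPolynomial (Fin 2) K), X 1]) hN
    rw [map_mul, ← h, map_pow, aeval_X] at h2
    simp only [Matrix.cons_val_one] at h2
    rw [pow_add, ← mul_assoc, show F (t + 1) * X 1 ^ nseq (t + 1) * X 1 ^ N = _ from h2,
      ← AlgHom.comp_apply]
    congr 1
    ext i
    fin_cases i
    · simp [pow_succ]
      ring_nf
    · simp

end Substitution

section TangentCone

variable {K : Type*} [Field K]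

lemma minMonomialDeg_le {P : MvPolynomial (Fin 2) K} {a b : ℕ} (h : coeff (expXY a b) P ≠ 0) :
    minMonomialDeg P ≤ a + b :=
  Nat.sInf_le ⟨expXY a b, mem_support_iff.2 h, sum_expXY a b⟩

lemma coeff_tangentCone (P : MvPolynomial (Fin 2) K) (a b : ℕ) :
    coeff (expXY a b) (tangentCone P) =
      if a + b = minMonomialDeg P then coeff (expXY a b) P else 0 := by
  rw [tangentCone, coeff_homogeneousComponent]
  have : (expXY a b).degree = a + b := by
    rw [← sum_expXY a b]
    rfl
  rw [this]

lemma exists_of_not_X_zero_dvd {P : MvPolynomial (Fin 2) K} (h : ¬ X 0 ∣ P) :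
    ∃ y, coeff (expXY 0 y) P ≠ 0 := by
  rw [X_dvd_iff_modMonomial_eq_zero, ← ne_eq, ne_zero_iff] at h
  obtain ⟨s, hs⟩ := h
  by_cases h0 : Finsupp.single 0 1 ≤ s
  · exact absurd (coeff_modMonomial_of_le _ h0) hs
  · rw [coeff_modMonomial_of_not_le _ h0] at hs
    refine ⟨s 1, ?_⟩
    rw [Finsupp.single_le_iff] at h0
    have : s 0 = 0 := by omega
    rwa [← this, ← eq_expXY]

end TangentCone

section Binomial

lemma even_choose_of_dvd {v i k : ℕ} (hi : 2 ^ v ∣ i) (hk : 0 < k) (hkv : k < 2 ^ v) :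
    Even (i.choose k) := by
  obtain ⟨k, rfl⟩ := Nat.exists_eq_add_of_lt hk
  rw [zero_add] at *
  rcases Nat.eq_zero_or_pos i with rfl | hi0
  · simp
  obtain ⟨i, rfl⟩ := Nat.exists_eq_add_of_lt hi0
  rw [zero_add] at *
  by_contra h
  have h1 : 2 ^ v ∣ (i + 1).choose (k + 1) * (k + 1) := by
    rw [← Nat.add_one_mul_choose_eq]
    exact hi.mul_right _
  have h2 : Nat.Coprime (2 ^ v) ((i + 1).choose (k + 1)) :=
    Nat.Coprime.pow_left _ (Nat.coprime_two_left.2 (Nat.not_even_iff_odd.1 h))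
  have := Nat.le_of_dvd (by omega) (h2.dvd_of_dvd_mul_left h1)
  omega

lemma odd_choose_pred_of_dvd {v i k : ℕ} (hi0 : 0 < i) (hi : 2 ^ v ∣ i) (hkv : k < 2 ^ v) :
    Odd ((i - 1).choose k) := by
  obtain ⟨i, rfl⟩ := Nat.exists_eq_add_of_lt hi0
  rw [zero_add] at *
  rw [Nat.add_sub_cancel]
  induction k with
  | zero => simp
  | succ k ih =>
    have h := even_choose_of_dvd hi (Nat.succ_pos k) hkv
    rw [Nat.choose_succ_succ] at h
    have := ih (by omega)
    exact (Nat.even_add'.1 h).1 this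

end Binomial

section InitialPolynomial

variable {K : Type*} [Field K]

lemma coeff_initial (A : ℕ → K) (d k y : ℕ) :
    coeff (expXY k y) ((X 1 : MvPolynomial (Fin 2) K) ^ (d - 2) +
      ∑ i ∈ Finset.Icc 3 d, C (A i) * (X 1) ^ (d - i) *
        ∑ k ∈ Finset.range i, C ((((i - 1).choose k + 1 : ℕ) : K)) * (X 0) ^ k) =
    (if k = 0 ∧ y = d - 2 then 1 else 0) +
      ∑ i ∈ Finset.Icc 3 d, if d - i = y ∧ k < i then
        A i * (((i - 1).choose k + 1 : ℕ) : K) else 0 := by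
  classical
  rw [coeff_add, coeff_sum]
  congr 1
  · have := C_mul_X_pow_mul_X_pow (1 : K) 0 (d - 2)
    rw [C_1, one_mul, pow_zero, one_mul] at this
    rw [this, coeff_monomial]
    simp only [expXY_inj, eq_comm]
  · refine Finset.sum_congr rfl fun i _ => ?_
    have h : ∀ j, C (A i) * X 1 ^ (d - i) * (C ((((i - 1).choose j + 1 : ℕ) : K)) * X 0 ^ j) =
        monomial (expXY j (d - i)) (A i * ((((i - 1).choose j + 1 : ℕ) : K))) := by
      intro j
      rw [← C_mul_X_pow_mul_X_pow, C_mul]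
      ring
    simp only [Finset.mul_sum, h, coeff_sum, coeff_monomial, expXY_inj]
    by_cases hy : d - i = y
    · simp [hy]
    · simp [hy]

lemma coeff_initial_eq (A : ℕ → K) {d k i : ℕ} (hk : 1 ≤ k) (hki : k < i) (hi : 3 ≤ i)
    (hid : i ≤ d) :
    coeff (expXY k (d - i)) ((X 1 : MvPolynomial (Fin 2) K) ^ (d - 2) +
      ∑ i ∈ Finset.Icc 3 d, C (A i) * (X 1) ^ (d - i) *
        ∑ k ∈ Finset.range i, C ((((i - 1).choose k + 1 : ℕ) : K)) * (X 0) ^ k) =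
    A i * (((i - 1).choose k + 1 : ℕ) : K) := by
  rw [coeff_initial, if_neg (by omega), zero_add, Finset.sum_eq_single i]
  · rw [if_pos ⟨rfl, hki⟩]
  · intro j hj hji
    rw [Finset.mem_Icc] at hj
    rw [if_neg (by omega)]
  · intro h
    exact absurd (Finset.mem_Icc.2 ⟨hi, hid⟩) h

lemma coeff_initial_zero_left [CharP K 2] (A : ℕ → K) (d y : ℕ) :
    coeff (expXY 0 y) ((X 1 : MvPolynomial (Fin 2) K) ^ (d - 2) +
      ∑ i ∈ Finset.Icc 3 d, C (A i) * (X 1) ^ (d - i) *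
        ∑ k ∈ Finset.range i, C ((((i - 1).choose k + 1 : ℕ) : K)) * (X 0) ^ k) =
    if y = d - 2 then 1 else 0 := by
  have h2 : ((1 + 1 : ℕ) : K) = 0 := CharP.cast_eq_zero K 2
  rw [coeff_initial, Finset.sum_eq_zero, add_zero]
  · simp
  · intro i _
    rw [Nat.choose_zero_right, h2]
    simp

lemma exists_of_coeff_initial_ne_zero (A : ℕ → K) {d k y : ℕ} (hk : 1 ≤ k)
    (h : coeff (expXY k y) ((X 1 : MvPolynomial (Fin 2) K) ^ (d - 2) +
      ∑ i ∈ Finset.Icc 3 d, C (A i) * (X 1) ^ (d - i) *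
        ∑ k ∈ Finset.range i, C ((((i - 1).choose k + 1 : ℕ) : K)) * (X 0) ^ k) ≠ 0) :
    ∃ i, 3 ≤ i ∧ i ≤ d ∧ y = d - i ∧ k < i ∧ A i ≠ 0 ∧ (((i - 1).choose k + 1 : ℕ) : K) ≠ 0 := by
  rw [coeff_initial, if_neg (by omega), zero_add] at h
  obtain ⟨i, hi, hne⟩ := Finset.exists_ne_zero_of_sum_ne_zero h
  rw [ne_eq, ite_eq_right_iff, Classical.not_imp] at hne
  rw [Finset.mem_Icc] at hi
  exact ⟨i, hi.1, hi.2, hne.1.1.symm, hne.1.2, left_ne_zero_of_mul hne.2,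
    right_ne_zero_of_mul hne.2⟩

lemma two_pow_padicValNat_lt_of_odd [CharP K 2] {i k : ℕ} (hi0 : 0 < i) (hi : Even i) (hk : Odd k)
    (h : (((i - 1).choose k + 1 : ℕ) : K) ≠ 0) : 2 ^ padicValNat 2 i < k := by
  by_contra! hle
  have hv : padicValNat 2 i ≠ 0 := by
    intro h0
    rw [padicValNat.eq_zero_iff] at h0
    have := hi.two_dvd
    omega
  have hne : k ≠ 2 ^ padicValNat 2 i := by
    rintro rfl
    exact (Nat.not_even_iff_odd.2 hk) ((Nat.even_pow.2 ⟨even_two, hv⟩))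
  have hodd := odd_choose_pred_of_dvd hi0 pow_padicValNat_dvd (lt_of_le_of_ne hle hne)
  exact h ((CharP.cast_eq_zero_iff K 2 _).2 hodd.add_one.two_dvd)

end InitialPolynomial


set_option maxHeartbeats 400000 in
theorem low_degree_monomials_even
    {K : Type*} [Field K] [Fintype K] (n : ℕ) (hn : 1 ≤ n)
    (hcard : Fintype.card K = 2 ^ n)
    (f : Polynomial K) (d : ℕ) (hd : f.natDegree = d) (hd3 : 3 ≤ d)
    (hAd : f.coeff d ≠ 0)
    (hdeg : d ^ 4 ≤ Fintype.card K)
    (h2pow : ∀ i k : ℕ, i = 2 ^ k → f.coeff i = 0)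
    (hplanar : ∀ ε : K, ε ≠ 0 →
      Function.Bijective fun x : K => f.eval (x + ε) + f.eval x + ε * x)
    (F : ℕ → MvPolynomial (Fin 2) K) (nseq : ℕ → ℕ)
    (hF0 : F 0 = (X 1 : MvPolynomial (Fin 2) K) ^ (d - 2) +
      ∑ i ∈ Finset.Icc 3 d, C (f.coeff i) * (X 1) ^ (d - i) *
        ∑ k ∈ Finset.range i, C ((((i - 1).choose k + 1 : ℕ) : K)) * (X 0) ^ k)
    (hnseq : ∀ r : ℕ, 1 ≤ r →
      IsLeast {m : ℕ | ∃ s ∈ (F (r - 1)).support, (s.sum fun _ e => e) = m} (nseq r))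
    (hFr : ∀ r : ℕ, 1 ≤ r →
      F r * (X 1 : MvPolynomial (Fin 2) K) ^ (nseq r) = aeval ![X 0 * X 1, X 1] (F (r - 1)))
    (t : ℕ) (ht1 : 1 ≤ t)
    (ht : ¬ (X 0 : MvPolynomial (Fin 2) K) ∣ tangentCone (F t))
    (htleast : ∀ s : ℕ, s < t → (X 0 : MvPolynomial (Fin 2) K) ∣ tangentCone (F s))
    (u : ℕ)
    (hu : IsLeast {u' : ℕ | ∃ ℓ : ℕ,
      (tangentCone (F (t - 1))).coeff
        (Finsupp.single (0 : Fin 2) (2 ^ u') + Finsupp.single (1 : Fin 2) ℓ) ≠ 0} u)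
    (Ft1 Ft2 : MvPolynomial (Fin 2) K)
    (hFt1 : Ft1 * (X 0 : MvPolynomial (Fin 2) K) ^ (2 ^ u - 2) = aeval ![X 0, X 0 * X 1] (F t))
    (hFt2 : Ft2 * (X 1 : MvPolynomial (Fin 2) K) ^ (2 ^ u - 4) =
      aeval ![X 0 * (X 1) ^ (2 ^ (u - 1) - 2), X 1] Ft1)
    (o : ℕ → ℤ)
    (hoodd : ∀ i : ℕ, Odd i →
      o i = 2 ^ (u - 1) * ((t : ℤ) + 1) - 1 - 2 ^ (u - 1) * (i : ℤ) + 2 ^ u + 2)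
    (hoeven : ∀ i : ℕ, Even i →
      o i = (2 ^ (padicValNat 2 i) + 1) * (2 ^ (u - 1) * ((t : ℤ) + 1) - 1)
        - 2 ^ (u - 1) * (i : ℤ) + 2 ^ u + 2)
    (m : ℤ)
    (hm : IsLeast {x : ℤ | ∃ i : ℕ, 3 ≤ i ∧ i ≤ d ∧ f.coeff i ≠ 0 ∧ o i = x} m)
    :
    ∀ a b : ℕ,
      Ft2.coeff (Finsupp.single (0 : Fin 2) a + Finsupp.single (1 : Fin 2) b) ≠ 0 →
      ((a : ℤ) + (b : ℤ) < m) → Even a ∧ Even b := by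
  intro a b hab hlt
  change coeff (expXY a b) Ft2 ≠ 0 at hab
  have : CharP K 2 := charP_of_card_eq_prime_pow (f := n) hcard
  obtain ⟨N, hN⟩ := exists_aeval_iterate F nseq hFr t
  obtain ⟨e, he⟩ := exists_of_not_X_zero_dvd ht
  rw [coeff_tangentCone, ne_eq, ite_eq_right_iff, Classical.not_imp] at he
  obtain ⟨hemin, he⟩ := he
  have heN : e + N = d - 2 := by
    obtain ⟨y', hy', h⟩ := exists_of_mul_eq_aeval_left hN he
    rw [hF0, coeff_initial_zero_left, ne_eq, ite_eq_right_iff, Classical.not_imp] at h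
    omega
  have hsupp : ∀ k y, coeff (expXY k y) (F t) ≠ 0 → (k = 0 ∧ y = e) ∨
      (1 ≤ k ∧ ∃ i, 3 ≤ i ∧ i ≤ d ∧ k < i ∧ f.coeff i ≠ 0 ∧
        (((i - 1).choose k + 1 : ℕ) : K) ≠ 0 ∧ y + i = e + 2 + t * k) := by
    intro k y h
    obtain ⟨y', hy', h⟩ := exists_of_mul_eq_aeval_left hN h
    rw [hF0] at h
    rcases Nat.eq_zero_or_pos k with rfl | hk
    · rw [coeff_initial_zero_left, ne_eq, ite_eq_right_iff, Classical.not_imp] at h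
      omega
    · obtain ⟨i, hi3, hid, rfl, hki, hAi, hbin⟩ := exists_of_coeff_initial_ne_zero _ hk h
      exact Or.inr ⟨hk, i, hi3, hid, hki, hAi, hbin, by omega⟩
  have hexp : ∀ k i, 1 ≤ k → k < i → 3 ≤ i → i ≤ d → f.coeff i ≠ 0 →
      Odd ((i - 1).choose k + 1) → i ≤ e + 2 + t * k := by
    intro k i hk hki hi3 hid hAi hbin
    have h : coeff (expXY k (d - i)) (F 0) ≠ 0 := by
      rw [hF0, coeff_initial_eq _ hk hki hi3 hid]
      refine mul_ne_zero hAi ?_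
      rw [ne_eq, CharP.cast_eq_zero_iff K 2, ← even_iff_two_dvd, Nat.not_even_iff_odd]
      exact hbin
    have := le_of_mul_eq_aeval_left hN h
    omega
  have hstep : F t * X 1 ^ nseq t = aeval ![X 0 * X 1 ^ 1, X 1] (F (t - 1)) := by
    rw [pow_one]
    exact hFr t ht1
  have hmin : minMonomialDeg (F (t - 1)) = nseq t := (hnseq t ht1).csInf_eq
  obtain ⟨⟨ℓ, hℓ⟩, hulb⟩ := hu
  change coeff (expXY (2 ^ u) ℓ) _ ≠ 0 at hℓ
  rw [coeff_tangentCone, ne_eq, ite_eq_right_iff, Classical.not_imp, hmin] at hℓ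
  have hXu : coeff (expXY (2 ^ u) 0) (F t) ≠ 0 := by
    rw [coeff_of_mul_eq_aeval_left hstep (y' := ℓ) (by omega)]
    exact hℓ.2
  have hX1 : coeff (expXY 1 0) (F t) ≠ 0 → u ≤ 0 := by
    intro h
    obtain ⟨y', hy', h⟩ := exists_of_mul_eq_aeval_left hstep h
    refine hulb ⟨y', ?_⟩
    change coeff (expXY (2 ^ 0) y') (tangentCone (F (t - 1))) ≠ 0
    rw [pow_zero, coeff_tangentCone, if_pos (by omega)]
    exact h
  have hele : e ≤ 2 ^ u := by
    have := minMonomialDeg_le hXu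
    omega
  have hege := le_of_mul_eq_aeval_right hFt1 he
  have hupos : 0 < 2 ^ u := by positivity
  obtain ⟨-, i₀, hi₀3, hi₀d, hui₀, hAi₀, hbin₀, hi₀⟩ := (hsupp _ _ hXu).resolve_left (by omega)
  have hmo : ∀ i, 3 ≤ i → i ≤ d → f.coeff i ≠ 0 → m ≤ o i :=
    fun i h1 h2 h3 => hm.2 ⟨i, h1, h2, h3, rfl⟩
  rcases Nat.eq_zero_or_pos u with rfl | hu0
  · have hodd : Odd i₀ := by
      rw [ne_eq, CharP.cast_eq_zero_iff K 2, pow_zero, Nat.choose_one_right,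
        ← even_iff_two_dvd, Nat.not_even_iff_odd, Nat.sub_add_cancel (by omega)] at hbin₀
      exact hbin₀
    have h := hmo i₀ hi₀3 hi₀d hAi₀
    rw [hoodd i₀ hodd] at h
    simp only [zero_tsub, pow_zero, one_mul, mul_one] at h hi₀
    have ha : a = 0 := by omega
    have hb : b = 0 := by omega
    simp [ha, hb]
  obtain ⟨k, hlow⟩ : ∃ k y, b + (2 ^ u - 4) = (2 ^ (u - 1) - 2) * a + y ∧
      a + (2 ^ u - 2) = k + y ∧ coeff (expXY k y) (F t) ≠ 0 := by
    obtain ⟨y, hby, h⟩ := exists_of_mul_eq_aeval_left hFt2 hab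
    obtain ⟨k, hak, h⟩ := exists_of_mul_eq_aeval_right hFt1 h
    exact ⟨k, y, hby, hak, h⟩
  obtain ⟨y, hby, hak, hky⟩ := hlow
  have hoform : ∀ i, 3 ≤ i → (((i - 1).choose k + 1 : ℕ) : K) ≠ 0 → 1 ≤ k →
      ¬ (Even i ∧ Even k) → ∃ k₀ : ℤ, k₀ ≤ k ∧
        o i = k₀ * (2 ^ (u - 1) * ((t : ℤ) + 1) - 1) - 2 ^ (u - 1) * (i : ℤ) + 2 ^ u + 2 := by
    intro i hi3 hbin hk hpar
    rcases Nat.even_or_odd i with hi | hi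
    · refine ⟨2 ^ padicValNat 2 i + 1, ?_, hoeven i hi⟩
      have hkodd : Odd k := Nat.not_even_iff_odd.1 fun h => hpar ⟨hi, h⟩
      have := two_pow_padicValNat_lt_of_odd (K := K) (by omega) hi hkodd hbin
      exact_mod_cast this
    · exact ⟨1, by exact_mod_cast hk, by rw [hoodd i hi, one_mul]⟩
  have hne : e + 1 ≠ 2 ^ u := by
    intro h
    have hpar : Even (2 ^ u) := Nat.even_pow.2 ⟨even_two, hu0.ne'⟩
    have hodd : Odd i₀ := by
      have : i₀ = 2 ^ u + t * 2 ^ u + 1 := by omega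
      rw [this]
      exact (hpar.add (hpar.mul_left t)).add_one
    have h1 := hexp 1 i₀ le_rfl (by omega) hi₀3 hi₀d hAi₀ (by
      rwa [Nat.choose_one_right, Nat.sub_add_cancel (by omega)])
    have h2 : 2 ^ 1 ≤ 2 ^ u := Nat.pow_le_pow_right two_pos hu0
    nlinarith
  obtain ⟨v, rfl⟩ : ∃ v, u = v + 1 := ⟨u - 1, by omega⟩
  simp only [Nat.add_sub_cancel] at hby hoform
  rcases Nat.eq_zero_or_pos v with rfl | hv0
  · simp only [zero_add, pow_zero, pow_one, Nat.reduceSub, zero_mul, one_mul, add_zero]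
      at hby hak hoform hele hne
    have he02 : e = 0 ∨ e = 2 := by omega
    rcases hsupp k y hky with ⟨rfl, rfl⟩ | ⟨hk, i, hi3, hid, hki, hAi, hbin, hyi⟩
    · obtain rfl : a = b := by omega
      obtain rfl : a = y := by omega
      rcases he02 with rfl | rfl <;> decide
    by_cases hpar : Even i ∧ Even k
    · have htk := hpar.2.mul_left t
      obtain ⟨⟨i', hi'⟩, ⟨k', hk'⟩⟩ := hpar
      obtain ⟨s, hs⟩ := htk
      simp only [Nat.even_iff]
      omega
    exfalso
    obtain ⟨k₀, hk₀, ho⟩ := hoform i hi3 hbin hk hpar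
    have hmoi := hmo i hi3 hid hAi
    have hkt : k₀ * (t : ℤ) ≤ k * t := mul_le_mul_of_nonneg_right hk₀ (by positivity)
    have hyi' : (y : ℤ) + i = e + 2 + k * t := by
      rw [mul_comm (k : ℤ)]
      exact_mod_cast hyi
    rw [add_sub_cancel_right] at ho
    have hky1 : ¬ (k = 1 ∧ y = 0) := by
      rintro ⟨rfl, rfl⟩
      exact absurd (hX1 hky) (by omega)
    omega
  · obtain ⟨w, hw⟩ : ∃ w, 2 ^ v = 2 * w + 2 := by
      obtain ⟨v, rfl⟩ : ∃ v', v = v' + 1 := ⟨v - 1, by omega⟩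
      have : 0 < 2 ^ v := by positivity
      exact ⟨2 ^ v - 1, by rw [pow_succ]; omega⟩
    have hne' : e ≠ 2 ^ (v + 1) := by
      intro h
      have hi₀' : i₀ = 4 * (w + 1 + t * (w + 1)) + 2 := by
        have : t * 2 ^ (v + 1) = 4 * (t * (w + 1)) := by
          rw [pow_succ, hw]
          ring
        rw [this, h, pow_succ, hw] at hi₀
        omega
      have h1 := hexp 2 i₀ one_le_two (by omega) hi₀3 hi₀d hAi₀ (by
        apply Even.add_one
        have h3 := Nat.add_one_mul_choose_eq (i₀ - 2) 1
        rw [Nat.choose_one_right, show i₀ - 2 + 1 = i₀ - 1 by omega] at h3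
        have h4 : i₀ - 2 = 4 * (w + 1 + t * (w + 1)) := by omega
        rw [h4] at h3
        exact ⟨(i₀ - 1) * (w + 1 + t * (w + 1)), by linarith⟩)
      rw [h, pow_succ, hw] at h1
      nlinarith
    have hpow : 2 ^ (v + 1) = 4 * w + 4 := by
      rw [pow_succ, hw]
      ring
    have hpowZ : (2 : ℤ) ^ (v + 1) = 4 * w + 4 := by exact_mod_cast hpow
    have hwZ : (2 : ℤ) ^ v = 2 * w + 2 := by exact_mod_cast hw
    rw [hpow] at hele hege hne hne' hby hak
    rw [hw] at hby
    obtain rfl : e = 4 * w + 2 := by omega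
    simp only [Nat.add_sub_cancel] at hby
    rw [show 4 * w + 4 - 2 = 4 * w + 2 by omega] at hak
    rcases hsupp k y hky with ⟨rfl, rfl⟩ | ⟨hk, i, hi3, hid, hki, hAi, hbin, hyi⟩
    · obtain rfl : a = 0 := by omega
      obtain rfl : b = 2 := by omega
      decide
    by_cases hpar : Even i ∧ Even k
    · have htk := hpar.2.mul_left t
      obtain ⟨⟨i', hi'⟩, ⟨k', hk'⟩⟩ := hpar
      obtain ⟨s, hs⟩ := htk
      rw [mul_assoc] at hby
      simp only [Nat.even_iff]
      omega
    exfalso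
    obtain ⟨k₀, hk₀, ho⟩ := hoform i hi3 hbin hk hpar
    have hmoi := hmo i hi3 hid hAi
    rw [hpowZ, hwZ] at ho
    have hslope : 0 ≤ (2 * w + 2) * ((t : ℤ) + 1) - 1 := by
      have h : (2 * w + 2) * ((t : ℤ) + 1) - 1 = 2 * w * (t + 1) + 2 * t + 1 := by ring
      rw [h]
      positivity
    have hmono := mul_le_mul_of_nonneg_right hk₀ hslope
    have hyiZ : (y : ℤ) + i = 4 * w + 2 + 2 + t * k := by exact_mod_cast hyi
    have hbyZ : (b : ℤ) + 4 * w = 2 * w * a + y := by exact_mod_cast hby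
    have hakZ : (a : ℤ) + (4 * w + 2) = k + y := by exact_mod_cast hak
    have hsum : (a : ℤ) + b = k * ((2 * w + 2) * ((t : ℤ) + 1) - 1) - (2 * w + 2) * i
        + (4 * w + 4) + 2 := by
      linear_combination hbyZ + (2 * w + 1) * hakZ + (2 * w + 2) * hyiZ
    linarith
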